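/- Let d ≥ 1 be an integer and λ₁, …, λ_d > 0 with (1/d) ∑ᵢ λᵢ = 1; set λmin := minᵢ λᵢ and λmax := maxᵢ λᵢ. Let ζ > 0, c > 0, γ > 0, ρ > 0. Let η̃ : [0,1] → [0,∞) be continuously differentiable with η̃(t) ≤ 2/γ for all t, and set σ̃²(t) := −(η̃²)'(t)/ρ², assumed nonnegative on [0,1]. Suppose D₁, …, D_d : [0,1] → ℝ are differentiable with Dᵢ(0) ≥ 0 and Dᵢ'(t) = −2 λᵢ η̃(t) μ_c(R(t)) Dᵢ(t) + λᵢ η̃(t)² ν_c(R(t)) (R(t) + ζ²/2) γ + 2 c² σ̃²(t) γ² for all t ∈ [0,1], where R(t) := (1/d) ∑ᵢ λᵢ Dᵢ(t). Let R̄ and R̲ be differentiable solutions on [0,1] of R̄'(t) = −2 λmin η̃(t) μ_c(R̄(t)) R̄(t) + λmax η̃(t)² ν_c(R̄(t)) (R̄(t) + ζ²/2) γ + 2 c² σ̃²(t) γ² and R̲'(t) = −2 λmax η̃(t) μ_c(R̲(t)) R̲(t) + η̃(t)² ν_c(R̲(t)) (R̲(t) + ζ²/2) γ + 2 c² σ̃²(t)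 γ², with R̄(0) = R̲(0) = R(0). Then R̲(t) ≤ R(t) ≤ R̄(t) for all t ∈ [0,1]. -/

import Mathlib

open MeasureTheory Real

/-- The error function `erf z = (2/√π) ∫₀^z e^{−t²} dt`. -/
noncomputable def erf (z : ℝ) : ℝ := 2 / Real.sqrt π * ∫ t in (0:ℝ)..z, Real.exp (-t ^ 2)

/-- `F(z) = erf(z/√2) − √(2/π) · z · e^{−z²/2}`. -/
noncomputable def F (z : ℝ) : ℝ :=
  erf (z / Real.sqrt 2) - Real.sqrt (2 / π) * z * Real.exp (-z ^ 2 / 2)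

/-- Descent reduction factor `μ_c(R) = erf(c'(R)/√2)` with `c'(R) = c/√(2R+ζ²)`. -/
noncomputable def mu (ζ c R : ℝ) : ℝ := erf (c / Real.sqrt (2 * R + ζ ^ 2) / Real.sqrt 2)

/-- Variance reduction factor `ν_c(R) = c'(R)²(1 − erf(c'(R)/√2)) + F(c'(R))`. -/
noncomputable def nu (ζ c R : ℝ) : ℝ :=
  (c / Real.sqrt (2 * R + ζ ^ 2)) ^ 2 *
      (1 - erf (c / Real.sqrt (2 * R + ζ ^ 2) / Real.sqrt 2))
    + F (c / Real.sqrt (2 * R + ζ ^ 2))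

theorem hasDerivAt_erf (z : ℝ) :
    HasDerivAt erf (2 / Real.sqrt π * Real.exp (-z ^ 2)) z := by
  have hcont : Continuous fun t : ℝ => Real.exp (-t ^ 2) := by fun_prop
  exact (intervalIntegral.integral_hasDerivAt_right (hcont.intervalIntegrable _ _)
    (hcont.stronglyMeasurableAtFilter _ _) hcont.continuousAt).const_mul _

theorem contDiff_erf : ContDiff ℝ 1 erf := by
  have hderiv : deriv erf = fun z => 2 / Real.sqrt π * Real.exp (-z ^ 2) :=
    funext fun z => (hasDerivAt_erf z).deriv
  refine contDiff_one_iff_deriv.2 ⟨fun z => (hasDerivAt_erf z).differentiableAt, ?_⟩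
  rw [hderiv]
  fun_prop

theorem contDiff_F : ContDiff ℝ 1 F := by
  have := contDiff_erf
  unfold F
  fun_prop

theorem erf_nonneg {z : ℝ} (hz : 0 ≤ z) : 0 ≤ erf z :=
  mul_nonneg (by positivity)
    (intervalIntegral.integral_nonneg hz fun t _ => (Real.exp_pos _).le)

theorem erf_le_one {z : ℝ} (hz : 0 ≤ z) : erf z ≤ 1 := by
  have hint : Integrable fun t : ℝ => Real.exp (-1 * t ^ 2) :=
    integrable_exp_neg_mul_sq one_pos
  have hle : ∫ t in (0:ℝ)..z, Real.exp (-t ^ 2) ≤ Real.sqrt π / 2 := by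
    have hIoi := integral_gaussian_Ioi 1
    rw [div_one] at hIoi
    rw [intervalIntegral.integral_of_le hz, ← hIoi]
    simp only [neg_mul, one_mul] at hint ⊢
    exact setIntegral_mono_set hint.integrableOn
      (Filter.Eventually.of_forall fun t => (Real.exp_pos _).le)
      (Set.Ioc_subset_Ioi_self).eventuallyLE
  have hpi : 0 < Real.sqrt π := Real.sqrt_pos.2 Real.pi_pos
  calc erf z ≤ 2 / Real.sqrt π * (Real.sqrt π / 2) :=
        mul_le_mul_of_nonneg_left hle (by positivity)
    _ = 1 := by field_simp

theorem F_nonneg {z : ℝ} (hz : 0 ≤ z) : 0 ≤ F z := by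
  have hcont : Continuous fun t : ℝ => Real.exp (-t ^ 2) := by fun_prop
  have hz2 : 0 ≤ z / Real.sqrt 2 := by positivity
  have hle : z / Real.sqrt 2 * Real.exp (-z ^ 2 / 2)
      ≤ ∫ t in (0:ℝ)..(z / Real.sqrt 2), Real.exp (-t ^ 2) := by
    have hmono : ∫ _t in (0:ℝ)..(z / Real.sqrt 2), Real.exp (-z ^ 2 / 2)
        ≤ ∫ t in (0:ℝ)..(z / Real.sqrt 2), Real.exp (-t ^ 2) := by
      refine intervalIntegral.integral_mono_on hz2 (by simp) (hcont.intervalIntegrable _ _) ?_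
      intro t ht
      have hsq : t ^ 2 ≤ (z / Real.sqrt 2) ^ 2 := pow_le_pow_left₀ ht.1 ht.2 2
      rw [div_pow, Real.sq_sqrt zero_le_two] at hsq
      exact Real.exp_le_exp.2 (by linarith)
    simpa using hmono
  have hmul := mul_le_mul_of_nonneg_left hle (show 0 ≤ 2 / Real.sqrt π by positivity)
  have hconst : Real.sqrt (2 / π) = 2 / Real.sqrt π / Real.sqrt 2 := by
    rw [Real.sqrt_div zero_le_two, div_right_comm, Real.div_sqrt]
  unfold F
  rw [hconst, sub_nonneg]
  calc _ = 2 / Real.sqrt π * (z / Real.sqrt 2 * Real.exp (-z ^ 2 / 2)) := by ring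
    _ ≤ _ := hmul

theorem mu_nonneg (ζ : ℝ) {c : ℝ} (hc : 0 ≤ c) (x : ℝ) : 0 ≤ mu ζ c x :=
  erf_nonneg (by positivity)

theorem nu_nonneg (ζ : ℝ) {c : ℝ} (hc : 0 ≤ c) (x : ℝ) : 0 ≤ nu ζ c x :=
  add_nonneg (mul_nonneg (by positivity) (sub_nonneg.2 (erf_le_one (by positivity))))
    (F_nonneg (by positivity))

/-- When `x + ζ² / 2 < 0` the square root in `nu` vanishes, hence so does `nu ζ c x`. -/
theorem nu_mul_nonneg (ζ : ℝ) {c : ℝ} (hc : 0 ≤ c) (x : ℝ) :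
    0 ≤ nu ζ c x * (x + ζ ^ 2 / 2) := by
  rcases le_total 0 (x + ζ ^ 2 / 2) with h | h
  · exact mul_nonneg (nu_nonneg ζ hc x) h
  · have hsqrt : Real.sqrt (2 * x + ζ ^ 2) = 0 := Real.sqrt_eq_zero_of_nonpos (by linarith)
    simp [nu, hsqrt, F, erf]

theorem contDiffOn_clip {ζ : ℝ} (hζ : 0 < ζ) (c : ℝ) :
    ContDiffOn ℝ 1 (fun x : ℝ => c / Real.sqrt (2 * x + ζ ^ 2)) (Set.Ici 0) := by
  have hpos : ∀ x ∈ Set.Ici (0:ℝ), 0 < 2 * x + ζ ^ 2 := fun x hx => by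
    have : (0:ℝ) ≤ x := hx
    positivity
  exact contDiffOn_const.div (ContDiffOn.sqrt (by fun_prop) fun x hx => (hpos x hx).ne')
    fun x hx => (Real.sqrt_pos.2 (hpos x hx)).ne'

theorem contDiffOn_mu {ζ : ℝ} (hζ : 0 < ζ) (c : ℝ) : ContDiffOn ℝ 1 (mu ζ c) (Set.Ici 0) :=
  contDiff_erf.comp_contDiffOn ((contDiffOn_clip hζ c).div_const _)

theorem contDiffOn_nu {ζ : ℝ} (hζ : 0 < ζ) (c : ℝ) : ContDiffOn ℝ 1 (nu ζ c) (Set.Ici 0) :=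
  (((contDiffOn_clip hζ c).pow 2).mul (contDiffOn_const.sub (contDiffOn_mu hζ c))).add
    (contDiff_F.comp_contDiffOn (contDiffOn_clip hζ c))

/-- A `C¹` function on `[0, ∞)` is Lipschitz on `[0, M]`. -/
theorem exists_lipschitz_bound {f : ℝ → ℝ} (hf : ContDiffOn ℝ 1 f (Set.Ici 0)) (M : ℝ) :
    ∃ K : ℝ, 0 ≤ K ∧ ∀ x ∈ Set.Icc 0 M, ∀ y ∈ Set.Icc 0 M, |f x - f y| ≤ K * |x - y| := by
  obtain ⟨K, hK⟩ := (hf.mono Set.Icc_subset_Ici_self).exists_lipschitzOnWith one_ne_zero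
    (convex_Icc (0:ℝ) M) isCompact_Icc
  exact ⟨K, K.2, fun x hx y hy => by simpa [Real.dist_eq] using hK.dist_le_mul x hx y hy⟩

/-- Comparison principle under a one-sided Lipschitz bound where the order is violated. -/
theorem le_of_deriv_sub_le {u v u' v' : ℝ → ℝ} {L : ℝ}
    (hu : ∀ t ∈ Set.Icc (0:ℝ) 1, HasDerivAt u (u' t) t)
    (hv : ∀ t ∈ Set.Icc (0:ℝ) 1, HasDerivAt v (v' t) t) (h0 : u 0 ≤ v 0)
    (h : ∀ t ∈ Set.Icc (0:ℝ) 1, v t < u t → u' t - v' t ≤ L * (u t - v t)) :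
    ∀ t ∈ Set.Icc (0:ℝ) 1, u t ≤ v t := by
  intro t ht
  refine le_of_forall_pos_le_add fun ε hε => ?_
  have hE : 0 < Real.exp ((L + 1) * t) := Real.exp_pos _
  set δ := ε / Real.exp ((L + 1) * t) with hδ
  have hδ0 : 0 < δ := by positivity
  have hB : ∀ s, HasDerivAt (fun s => δ * Real.exp ((L + 1) * s))
      (δ * (Real.exp ((L + 1) * s) * (L + 1))) s := fun s => by
    simpa using ((((hasDerivAt_id s).const_mul (L + 1)).exp).const_mul δ)
  have hw : ∀ s ∈ Set.Icc (0:ℝ) 1, HasDerivAt (fun s => u s - v s) (u' s - v' s) s :=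
    fun s hs => (hu s hs).sub (hv s hs)
  have key := image_le_of_deriv_right_lt_deriv_boundary (f := fun s => u s - v s)
    (f' := fun s => u' s - v' s) (a := 0) (b := 1)
    (fun s hs => (hw s hs).continuousAt.continuousWithinAt)
    (fun s hs => (hw s ⟨hs.1, hs.2.le⟩).hasDerivWithinAt)
    (by simp; linarith) hB
    (fun s hs heq => by
      have hpos : 0 < δ * Real.exp ((L + 1) * s) := by positivity
      have hle := h s ⟨hs.1, hs.2.le⟩ (by linarith)
      rw [heq] at hle
      linarith) ht
  have hδt : δ * Real.exp ((L + 1) * t) = ε := div_mul_cancel₀ _ hE.ne'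
  linarith

theorem nonneg_of_neg_mul_le_deriv {f f' a : ℝ → ℝ}
    (hf : ∀ t ∈ Set.Icc (0:ℝ) 1, HasDerivAt f (f' t) t) (h0 : 0 ≤ f 0)
    (ha : ∀ t ∈ Set.Icc (0:ℝ) 1, 0 ≤ a t)
    (h : ∀ t ∈ Set.Icc (0:ℝ) 1, -a t * f t ≤ f' t) :
    ∀ t ∈ Set.Icc (0:ℝ) 1, 0 ≤ f t := by
  refine le_of_deriv_sub_le (u := fun _ => 0) (u' := fun _ => 0) (L := 0)
    (fun t _ => hasDerivAt_const t 0) hf h0 fun t ht hneg => ?_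
  nlinarith [h t ht, ha t ht]

/-- The common form of the right-hand sides of the scalar comparison equations. -/
noncomputable def drift (ζ c γ a b η s x : ℝ) : ℝ :=
  -2 * a * η * mu ζ c x * x + b * η ^ 2 * nu ζ c x * (x + ζ ^ 2 / 2) * γ + s

theorem nonneg_of_hasDerivAt_drift {ζ c γ a b : ℝ} (hc : 0 ≤ c) (hγ : 0 ≤ γ) (ha : 0 ≤ a)
    (hb : 0 ≤ b) {η s f : ℝ → ℝ} (hη : ∀ t ∈ Set.Icc (0:ℝ) 1, 0 ≤ η t)
    (hs : ∀ t ∈ Set.Icc (0:ℝ) 1, 0 ≤ s t) (h0 : 0 ≤ f 0)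
    (hf : ∀ t ∈ Set.Icc (0:ℝ) 1, HasDerivAt f (drift ζ c γ a b (η t) (s t) (f t)) t) :
    ∀ t ∈ Set.Icc (0:ℝ) 1, 0 ≤ f t := by
  refine nonneg_of_neg_mul_le_deriv (a := fun t => 2 * a * η t * mu ζ c (f t)) hf h0
    (fun t ht => ?_) fun t ht => ?_
  · have := hη t ht
    have := mu_nonneg ζ hc (f t)
    positivity
  · have hν := mul_nonneg (mul_nonneg (mul_nonneg hb (sq_nonneg (η t))) hγ)
      (nu_mul_nonneg ζ hc (f t))
    have := hs t ht
    unfold drift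
    linarith

theorem le_of_drift_inequalities {ζ c γ a b B : ℝ} (hζ : 0 < ζ) (hγ : 0 ≤ γ) (ha : 0 ≤ a)
    (hb : 0 ≤ b) {η s u v u' v' : ℝ → ℝ} (hη : ∀ t ∈ Set.Icc (0:ℝ) 1, 0 ≤ η t)
    (hηB : ∀ t ∈ Set.Icc (0:ℝ) 1, η t ≤ B)
    (hu0 : ∀ t ∈ Set.Icc (0:ℝ) 1, 0 ≤ u t) (hv0 : ∀ t ∈ Set.Icc (0:ℝ) 1, 0 ≤ v t)
    (h0 : u 0 ≤ v 0)
    (hu : ∀ t ∈ Set.Icc (0:ℝ) 1, HasDerivAt u (u' t) t)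
    (hv : ∀ t ∈ Set.Icc (0:ℝ) 1, HasDerivAt v (v' t) t)
    (hu' : ∀ t ∈ Set.Icc (0:ℝ) 1, u' t ≤ drift ζ c γ a b (η t) (s t) (u t))
    (hv' : ∀ t ∈ Set.Icc (0:ℝ) 1, drift ζ c γ a b (η t) (s t) (v t) ≤ v' t) :
    ∀ t ∈ Set.Icc (0:ℝ) 1, u t ≤ v t := by
  obtain ⟨M, hM⟩ := isCompact_Icc.bddAbove_image
    (fun t ht => (hu t ht).continuousAt.continuousWithinAt : ContinuousOn u (Set.Icc 0 1))
  obtain ⟨K, hK0, hK⟩ := exists_lipschitz_bound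
    ((contDiffOn_mu hζ c).mul contDiffOn_id) M
  obtain ⟨N, hN0, hN⟩ := exists_lipschitz_bound
    ((contDiffOn_nu hζ c).mul (contDiffOn_id.add (contDiffOn_const (c := ζ ^ 2 / 2)))) M
  refine le_of_deriv_sub_le (L := 2 * a * B * K + b * B ^ 2 * γ * N) hu hv h0
    fun t ht hlt => ?_
  have hη0 := hη t ht
  have hB := hηB t ht
  have huM : u t ≤ M := hM ⟨t, ht, rfl⟩
  have hut : u t ∈ Set.Icc 0 M := ⟨hu0 t ht, huM⟩
  have hvt : v t ∈ Set.Icc 0 M := ⟨hv0 t ht, hlt.le.trans huM⟩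
  have hK' := (abs_le.1 (hK _ hut _ hvt)).1
  have hN' := (abs_le.1 (hN _ hut _ hvt)).2
  have hw : 0 < u t - v t := sub_pos.2 hlt
  simp only [id, abs_of_pos hw] at hK' hN'
  have hKη := mul_le_mul_of_nonneg_left hK' (show 0 ≤ 2 * a * η t by positivity)
  have hNη := mul_le_mul_of_nonneg_left hN' (show 0 ≤ b * η t ^ 2 * γ by positivity)
  have hKB : 2 * a * η t * (K * (u t - v t)) ≤ 2 * a * B * (K * (u t - v t)) := by gcongr
  have hNB : b * η t ^ 2 * γ * (N * (u t - v t)) ≤ b * B ^ 2 * γ * (N * (u t - v t)) := by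
    gcongr
  have hu't := hu' t ht
  have hv't := hv' t ht
  unfold drift at hu't hv't
  linarith

/-- Sandwiching of the risk of the coupled ODE system (deterministic equivalent of DP-GD)
between the solutions of the scalar upper and lower ODEs. -/
theorem coupled_ode_risk_sandwich (d : ℕ) (hd : 0 < d) (lam : Fin d → ℝ)
    (hlam : ∀ i, 0 < lam i) (hmean : (1 / (d:ℝ)) * ∑ i, lam i = 1)
    (lmin lmax : ℝ) (hlmin : IsLeast (Set.range lam) lmin)
    (hlmax : IsGreatest (Set.range lam) lmax)
    (ζ c γ ρ : ℝ) (hζ : 0 < ζ) (hc : 0 < c) (hγ : 0 < γ) (hρ : 0 < ρ)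
    (η η' : ℝ → ℝ)
    (hη : ∀ t ∈ Set.Icc (0:ℝ) 1, HasDerivAt η (η' t) t)
    (hη' : ContinuousOn η' (Set.Icc (0:ℝ) 1))
    (hηnn : ∀ t ∈ Set.Icc (0:ℝ) 1, 0 ≤ η t)
    (hηle : ∀ t ∈ Set.Icc (0:ℝ) 1, η t ≤ 2 / γ)
    (σsq : ℝ → ℝ)
    (hσdef : ∀ t ∈ Set.Icc (0:ℝ) 1, σsq t = -(2 * η t * η' t) / ρ ^ 2)
    (hσnn : ∀ t ∈ Set.Icc (0:ℝ) 1, 0 ≤ σsq t)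
    (D : Fin d → ℝ → ℝ) (hD0 : ∀ i, 0 ≤ D i 0)
    (R : ℝ → ℝ) (hRdef : ∀ t, R t = (1 / (d:ℝ)) * ∑ i, lam i * D i t)
    (hD : ∀ i, ∀ t ∈ Set.Icc (0:ℝ) 1,
      HasDerivAt (D i)
        (-2 * lam i * η t * mu ζ c (R t) * D i t
          + lam i * (η t) ^ 2 * nu ζ c (R t) * (R t + ζ ^ 2 / 2) * γ
          + 2 * c ^ 2 * σsq t * γ ^ 2) t)
    (Rup Rlo : ℝ → ℝ) (hRup0 : Rup 0 = R 0) (hRlo0 : Rlo 0 = R 0)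
    (hRup : ∀ t ∈ Set.Icc (0:ℝ) 1,
      HasDerivAt Rup
        (-2 * lmin * η t * mu ζ c (Rup t) * Rup t
          + lmax * (η t) ^ 2 * nu ζ c (Rup t) * (Rup t + ζ ^ 2 / 2) * γ
          + 2 * c ^ 2 * σsq t * γ ^ 2) t)
    (hRlo : ∀ t ∈ Set.Icc (0:ℝ) 1,
      HasDerivAt Rlo
        (-2 * lmax * η t * mu ζ c (Rlo t) * Rlo t
          + (η t) ^ 2 * nu ζ c (Rlo t) * (Rlo t + ζ ^ 2 / 2) * γ
          + 2 * c ^ 2 * σsq t * γ ^ 2) t) :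
    ∀ t ∈ Set.Icc (0:ℝ) 1, Rlo t ≤ R t ∧ R t ≤ Rup t := by
  obtain ⟨imin, himin⟩ := hlmin.1
  have hlmin0 : 0 < lmin := himin ▸ hlam imin
  have hle_min : ∀ i, lmin ≤ lam i := fun i => hlmin.2 ⟨i, rfl⟩
  have hle_max : ∀ i, lam i ≤ lmax := fun i => hlmax.2 ⟨i, rfl⟩
  have hlmax0 : 0 < lmax := hlmin0.trans_le ((hle_min imin).trans (hle_max imin))
  have hdR : (0:ℝ) < d := Nat.cast_pos.2 hd
  set s : ℝ → ℝ := fun t => 2 * c ^ 2 * σsq t * γ ^ 2 with hs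
  have hs0 : ∀ t ∈ Set.Icc (0:ℝ) 1, 0 ≤ s t := fun t ht => by
    have := hσnn t ht
    positivity
  have hDnn : ∀ i, ∀ t ∈ Set.Icc (0:ℝ) 1, 0 ≤ D i t := fun i => by
    refine nonneg_of_neg_mul_le_deriv (a := fun t => 2 * lam i * η t * mu ζ c (R t))
      (hD i) (hD0 i) (fun t ht => ?_) fun t ht => ?_
    · have := hηnn t ht
      have := mu_nonneg ζ hc.le (R t)
      have := hlam i
      positivity
    · have hν := mul_nonneg (mul_nonneg (mul_nonneg (hlam i).le (sq_nonneg (η t))) hγ.le)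
        (nu_mul_nonneg ζ hc.le (R t))
      have := hs0 t ht
      simp only [hs] at this
      linarith
  have hRnn : ∀ t ∈ Set.Icc (0:ℝ) 1, 0 ≤ R t := fun t ht => by
    rw [hRdef]
    exact mul_nonneg (by positivity)
      (Finset.sum_nonneg fun i _ => mul_nonneg (hlam i).le (hDnn i t ht))
  have hR00 : 0 ≤ R 0 := hRnn 0 ⟨le_rfl, zero_le_one⟩
  set P : ℝ → ℝ := fun t => 1 / (d:ℝ) * ∑ i, lam i ^ 2 * D i t with hP
  set Q : ℝ := 1 / (d:ℝ) * ∑ i, lam i ^ 2 with hQ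
  set R' : ℝ → ℝ := fun t => -2 * η t * mu ζ c (R t) * P t
    + Q * (η t) ^ 2 * nu ζ c (R t) * (R t + ζ ^ 2 / 2) * γ + s t with hR'
  have hR : ∀ t ∈ Set.Icc (0:ℝ) 1, HasDerivAt R (R' t) t := fun t ht => by
    have hsum := (HasDerivAt.fun_sum (u := Finset.univ) fun i _ =>
      (hD i t ht).const_mul (lam i)).const_mul (1 / (d:ℝ))
    rw [← funext hRdef] at hsum
    refine hsum.congr_deriv (Eq.symm ?_)
    calc R' t = -2 * η t * mu ζ c (R t) * P t
          + Q * (η t) ^ 2 * nu ζ c (R t) * (R t + ζ ^ 2 / 2) * γ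
          + s t * (1 / (d:ℝ) * ∑ i, lam i) := by rw [hmean, mul_one]
      _ = _ := by
        simp only [hP, hQ, hs, Finset.mul_sum, Finset.sum_mul, ← Finset.sum_add_distrib]
        exact Finset.sum_congr rfl fun i _ => by ring
  have hPlo : ∀ t ∈ Set.Icc (0:ℝ) 1, lmin * R t ≤ P t := fun t ht => by
    rw [hRdef, mul_left_comm, Finset.mul_sum]
    refine mul_le_mul_of_nonneg_left (Finset.sum_le_sum fun i _ => ?_) (by positivity)
    nlinarith [mul_le_mul_of_nonneg_right (hle_min i) (mul_nonneg (hlam i).le (hDnn i t ht))]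
  have hPup : ∀ t ∈ Set.Icc (0:ℝ) 1, P t ≤ lmax * R t := fun t ht => by
    rw [hRdef, mul_left_comm, Finset.mul_sum]
    refine mul_le_mul_of_nonneg_left (Finset.sum_le_sum fun i _ => ?_) (by positivity)
    nlinarith [mul_le_mul_of_nonneg_right (hle_max i) (mul_nonneg (hlam i).le (hDnn i t ht))]
  have hQup : Q ≤ lmax := by
    calc Q ≤ 1 / (d:ℝ) * ∑ i, lmax * lam i := by
          refine mul_le_mul_of_nonneg_left (Finset.sum_le_sum fun i _ => ?_) (by positivity)
          nlinarith [mul_le_mul_of_nonneg_right (hle_max i) (hlam i).le]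
      _ = lmax := by rw [← Finset.mul_sum, mul_left_comm, hmean, mul_one]
  have hQlo : 1 ≤ Q := by
    have hle : 1 / (d:ℝ) * ∑ i, (2 * lam i - 1) ≤ Q := by
      refine mul_le_mul_of_nonneg_left (Finset.sum_le_sum fun i _ => ?_) (by positivity)
      nlinarith [sq_nonneg (lam i - 1)]
    have heq : 1 / (d:ℝ) * ∑ i, (2 * lam i - 1) = 1 := by
      rw [Finset.sum_sub_distrib, ← Finset.mul_sum, mul_sub, mul_left_comm, hmean]
      simp only [Finset.sum_const, Finset.card_univ, Fintype.card_fin, nsmul_eq_mul]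
      field_simp
      norm_num
    linarith
  have hμη : ∀ t ∈ Set.Icc (0:ℝ) 1, 0 ≤ 2 * η t * mu ζ c (R t) := fun t ht =>
    mul_nonneg (mul_nonneg zero_le_two (hηnn t ht)) (mu_nonneg ζ hc.le (R t))
  have hνη : ∀ t, 0 ≤ (η t) ^ 2 * γ * (nu ζ c (R t) * (R t + ζ ^ 2 / 2)) := fun t =>
    mul_nonneg (by positivity) (nu_mul_nonneg ζ hc.le (R t))
  have hR'up : ∀ t ∈ Set.Icc (0:ℝ) 1,
      R' t ≤ drift ζ c γ lmin lmax (η t) (s t) (R t) := fun t ht => by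
    have h1 := mul_le_mul_of_nonneg_left (hPlo t ht) (hμη t ht)
    have h2 := mul_le_mul_of_nonneg_right hQup (hνη t)
    simp only [hR', drift]
    linarith
  have hR'lo : ∀ t ∈ Set.Icc (0:ℝ) 1,
      drift ζ c γ lmax 1 (η t) (s t) (R t) ≤ R' t := fun t ht => by
    have h1 := mul_le_mul_of_nonneg_left (hPup t ht) (hμη t ht)
    have h2 := mul_le_mul_of_nonneg_right hQlo (hνη t)
    simp only [hR', drift]
    linarith
  have hRlo' : ∀ t ∈ Set.Icc (0:ℝ) 1,
      HasDerivAt Rlo (drift ζ c γ lmax 1 (η t) (s t) (Rlo t)) t := fun t ht => by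
    simpa only [drift, one_mul] using hRlo t ht
  have hRupnn := nonneg_of_hasDerivAt_drift hc.le hγ.le hlmin0.le hlmax0.le hηnn hs0
    (hRup0 ▸ hR00) hRup
  have hRlonn := nonneg_of_hasDerivAt_drift hc.le hγ.le hlmax0.le zero_le_one hηnn hs0
    (hRlo0 ▸ hR00) hRlo'
  intro t ht
  exact ⟨le_of_drift_inequalities hζ hγ.le hlmax0.le zero_le_one hηnn hηle hRlonn hRnn hRlo0.le
      hRlo' hR (fun _ _ => le_rfl) hR'lo t ht,
    le_of_drift_inequalities hζ hγ.le hlmin0.le hlmax0.le hηnn hηle hRnn hRupnn hRup0.ge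
      hR hRup hR'up (fun _ _ => le_rfl) t ht⟩
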